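/- arXiv:2505.08752 — 2 statements merged into one kernel-verified Lean document; each statement's English description precedes it below -/
import Mathlib

section
/- The tonnetz contains no 4-cycle: for any two distinct r₁, r₂ in ZMod 12 there is at most one s in ZMod 12 with s ∈ {r₁, r₁+4, r₁+9} and s ∈ {r₂, r₂+4, r₂+9}; and for any two distinct s₁, s₂ in ZMod 12 there is at most one r in ZMod 12 with s₁ ∈ {r, r+4, r+9} and s₂ ∈ {r, r+4, r+9}. -/
/-- The set `{0, 4, 9}` is a Sidon set in `ZMod 12`: its nonzero differences are distinct. -/
lemma eq_or_eq_of_sub_eq_sub_of_mem_zero_four_nine :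
    ∀ a ∈ ({0, 4, 9} : Finset (ZMod 12)), ∀ b ∈ ({0, 4, 9} : Finset (ZMod 12)),
      ∀ c ∈ ({0, 4, 9} : Finset (ZMod 12)), ∀ d ∈ ({0, 4, 9} : Finset (ZMod 12)),
        a - b = c - d → a = b ∨ a = c := by
  decide

lemma sub_mem_zero_four_nine {r s : ZMod 12}
    (h : s ∈ ({r, r + 4, r + 9} : Set (ZMod 12))) :
    s - r ∈ ({0, 4, 9} : Finset (ZMod 12)) := by
  rcases h with rfl | rfl | rfl <;> simp

lemma eq_or_eq_of_tonnetz_incident {r₁ r₂ s s' : ZMod 12}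
    (h₁ : s ∈ ({r₁, r₁ + 4, r₁ + 9} : Set (ZMod 12)))
    (h₂ : s ∈ ({r₂, r₂ + 4, r₂ + 9} : Set (ZMod 12)))
    (h₃ : s' ∈ ({r₁, r₁ + 4, r₁ + 9} : Set (ZMod 12)))
    (h₄ : s' ∈ ({r₂, r₂ + 4, r₂ + 9} : Set (ZMod 12))) :
    r₁ = r₂ ∨ s = s' :=
  (eq_or_eq_of_sub_eq_sub_of_mem_zero_four_nine
    _ (sub_mem_zero_four_nine h₁) _ (sub_mem_zero_four_nine h₂)
    _ (sub_mem_zero_four_nine h₃) _ (sub_mem_zero_four_nine h₄) (by ring)).imp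
    sub_right_injective.eq_iff.mp sub_left_injective.eq_iff.mp

/-- The tonnetz contains no 4-cycle: two distinct major roots are incident with at most one
common minor root, and two distinct minor roots are incident with at most one common major
root, where the major root `r` is incident with the minor root `s` iff `s ∈ {r, r+4, r+9}`. -/
theorem tonnetz_no_four_cycle :
    (∀ r₁ r₂ : ZMod 12, r₁ ≠ r₂ →
      ∀ s s' : ZMod 12,
        s ∈ ({r₁, r₁ + 4, r₁ + 9} : Set (ZMod 12)) →
        s ∈ ({r₂, r₂ + 4, r₂ + 9} : Set (ZMod 12)) →
        s' ∈ ({r₁, r₁ + 4, r₁ + 9} : Set (ZMod 12)) →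
        s' ∈ ({r₂, r₂ + 4, r₂ + 9} : Set (ZMod 12)) →
        s = s') ∧
    (∀ s₁ s₂ : ZMod 12, s₁ ≠ s₂ →
      ∀ r r' : ZMod 12,
        s₁ ∈ ({r, r + 4, r + 9} : Set (ZMod 12)) →
        s₂ ∈ ({r, r + 4, r + 9} : Set (ZMod 12)) →
        s₁ ∈ ({r', r' + 4, r' + 9} : Set (ZMod 12)) →
        s₂ ∈ ({r', r' + 4, r' + 9} : Set (ZMod 12)) →
        r = r') := by
  exact ⟨fun _ _ hr _ _ h₁ h₂ h₃ h₄ =>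
      (eq_or_eq_of_tonnetz_incident h₁ h₂ h₃ h₄).resolve_left hr,
    fun _ _ hs _ _ h₁ h₂ h₃ h₄ =>
      (eq_or_eq_of_tonnetz_incident h₁ h₃ h₂ h₄).resolve_right hs⟩
end

section
/- There are exactly six totals: the number of sets T of five synthemes on Fin 6 such that every duad (2-element subset of Fin 6) occurs as a block of exactly one syntheme in T (equivalently, the five synthemes are pairwise block-disjoint and their blocks together exhaust all 15 duads) is exactly 6. -/
/-- A syntheme: a partition of `Fin 6` into three pairwise disjoint 2-element blocks
(duads) whose union is all of `Fin 6`. -/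
def IsSyntheme (S : Finset (Finset (Fin 6))) : Prop :=
  S.card = 3 ∧ (∀ b ∈ S, b.card = 2) ∧
    (∀ b₁ ∈ S, ∀ b₂ ∈ S, b₁ ≠ b₂ → b₁ ∩ b₂ = ∅) ∧
    S.biUnion id = Finset.univ

instance : DecidablePred IsSyntheme := fun S => by
  unfold IsSyntheme; infer_instance

/-- A total: a set of five synthemes such that every duad (2-element subset of `Fin 6`)
occurs as a block of exactly one of them; equivalently, a one-factorization of the
complete graph on six vertices. -/
def IsTotalFamily (T : Finset (Finset (Finset (Fin 6)))) : Prop :=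
  T.card = 5 ∧ (∀ S ∈ T, IsSyntheme S) ∧
    ∀ D : Finset (Fin 6), D.card = 2 → (T.filter fun S => D ∈ S).card = 1

instance : DecidablePred IsTotalFamily := fun T => by
  unfold IsTotalFamily; infer_instance

/-- The three synthemes containing the duad `{0, a + 1}`, indexed by the partner of the smallest
of the four remaining points. -/
def synthemeThrough (p : Fin 5 × Fin 3) : Finset (Finset (Fin 6)) :=
  let x : Fin 4 → Fin 6 := fun i => (p.1.succAbove i).succ
  {{0, p.1.succ}, {x 0, x p.2.succ}, {x (p.2.succAbove 0).succ, x (p.2.succAbove 1).succ}}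

/-- The family choosing, for each `a`, one of the three synthemes containing `{0, a + 1}`. -/
def synthemeFamily (f : Fin 5 → Fin 3) : Finset (Finset (Finset (Fin 6))) :=
  Finset.univ.image fun a => synthemeThrough (a, f a)

theorem synthemeThrough_injective : Function.Injective synthemeThrough := by
  unfold Function.Injective
  decide +kernel

theorem exists_eq_synthemeThrough_of_disjoint :
    ∀ a : Fin 5, ∀ B ∈ Finset.powersetCard 2 (Finset.univ : Finset (Fin 6)),
      {0, a.succ} ∩ B = ∅ →
      ∀ C ∈ Finset.powersetCard 2 (Finset.univ : Finset (Fin 6)),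
        {0, a.succ} ∩ C = ∅ → B ∩ C = ∅ →
        ∃ j, ({{0, a.succ}, B, C} : Finset (Finset (Fin 6))) = synthemeThrough (a, j) := by
  decide +kernel

theorem IsSyntheme.exists_eq_synthemeThrough {S : Finset (Finset (Fin 6))} (hS : IsSyntheme S)
    {a : Fin 5} (ha : {0, a.succ} ∈ S) : ∃ j, S = synthemeThrough (a, j) := by
  obtain ⟨hcard, htwo, hdisj, -⟩ := hS
  have herase : (S.erase {0, a.succ}).card = 2 := by
    rw [Finset.card_erase_of_mem ha, hcard]
  obtain ⟨B, C, hBC, h⟩ := Finset.card_eq_two.mp herase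
  have hB : B ∈ S.erase {0, a.succ} := by simp [h]
  have hC : C ∈ S.erase {0, a.succ} := by simp [h]
  rw [Finset.mem_erase] at hB hC
  rw [← Finset.insert_erase ha, h]
  exact exists_eq_synthemeThrough_of_disjoint a
    B (Finset.mem_powersetCard_univ.mpr (htwo B hB.2)) (hdisj _ ha _ hB.2 hB.1.symm)
    C (Finset.mem_powersetCard_univ.mpr (htwo C hC.2)) (hdisj _ ha _ hC.2 hC.1.symm)
    (hdisj _ hB.2 _ hC.2 hBC)

theorem synthemeFamily_injective : Function.Injective synthemeFamily := by
  intro f g hfg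
  funext a
  have ha : synthemeThrough (a, f a) ∈ synthemeFamily g :=
    hfg ▸ Finset.mem_image_of_mem _ (Finset.mem_univ a)
  obtain ⟨b, -, hb⟩ := Finset.mem_image.mp ha
  have h := synthemeThrough_injective hb
  obtain rfl : b = a := congrArg Prod.fst h
  exact (congrArg Prod.snd h).symm

theorem card_synthemeFamily (f : Fin 5 → Fin 3) : (synthemeFamily f).card = 5 := by
  rw [synthemeFamily, Finset.card_image_of_injective, Finset.card_univ, Fintype.card_fin]
  exact fun a b h => congrArg Prod.fst (synthemeThrough_injective h)

theorem IsTotalFamily.exists_eq_synthemeFamily {T : Finset (Finset (Finset (Fin 6)))}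
    (hT : IsTotalFamily T) : ∃ f, synthemeFamily f = T := by
  obtain ⟨hcard, hsyn, hduad⟩ := hT
  have h (a : Fin 5) : ∃ j, synthemeThrough (a, j) ∈ T := by
    have hpos : 0 < (T.filter fun S => {0, a.succ} ∈ S).card := by
      rw [hduad _ (Finset.card_pair (Fin.succ_ne_zero a).symm)]
      exact one_pos
    obtain ⟨S, hS⟩ := Finset.card_pos.mp hpos
    rw [Finset.mem_filter] at hS
    obtain ⟨j, rfl⟩ := (hsyn S hS.1).exists_eq_synthemeThrough hS.2
    exact ⟨j, hS.1⟩
  choose f hf using h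
  refine ⟨f, Finset.eq_of_subset_of_card_le ?_ ?_⟩
  · exact Finset.image_subset_iff.mpr fun a _ => hf a
  · rw [hcard, card_synthemeFamily]

theorem isSyntheme_synthemeThrough : ∀ p, IsSyntheme (synthemeThrough p) := by
  decide +kernel

theorem isTotalFamily_synthemeFamily_iff (f : Fin 5 → Fin 3) :
    IsTotalFamily (synthemeFamily f) ↔
      ∀ a b, a ≠ b → Disjoint (synthemeThrough (a, f a)) (synthemeThrough (b, f b)) := by
  have hmem (a : Fin 5) : synthemeThrough (a, f a) ∈ synthemeFamily f :=
    Finset.mem_image_of_mem _ (Finset.mem_univ a)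
  constructor
  · rintro ⟨-, -, hduad⟩ a b hab
    refine Finset.disjoint_left.mpr fun D hDa hDb => hab ?_
    have hle := (hduad D ((isSyntheme_synthemeThrough _).2.1 D hDa)).le
    have h := Finset.card_le_one.mp hle _ (Finset.mem_filter.mpr ⟨hmem a, hDa⟩)
      _ (Finset.mem_filter.mpr ⟨hmem b, hDb⟩)
    exact congrArg Prod.fst (synthemeThrough_injective h)
  · intro hdisj
    refine ⟨card_synthemeFamily f, ?_, fun D hD => ?_⟩
    · exact Finset.forall_mem_image.mpr fun a _ => isSyntheme_synthemeThrough _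
    have hcover : Finset.univ.biUnion (fun a => synthemeThrough (a, f a)) =
        Finset.powersetCard 2 Finset.univ := by
      refine Finset.eq_of_subset_of_card_le ?_ ?_
      · exact Finset.biUnion_subset.mpr fun a _ B hB =>
          Finset.mem_powersetCard_univ.mpr ((isSyntheme_synthemeThrough _).2.1 B hB)
      · rw [Finset.card_biUnion fun a _ b _ hab => hdisj a b hab,
          Finset.sum_congr rfl fun a _ => (isSyntheme_synthemeThrough (a, f a)).1]
        decide
    have hDmem := Finset.mem_powersetCard_univ.mpr hD
    rw [← hcover, Finset.mem_biUnion] at hDmem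
    obtain ⟨a, -, ha⟩ := hDmem
    refine Finset.card_eq_one.mpr ⟨synthemeThrough (a, f a), ?_⟩
    refine Finset.eq_singleton_iff_unique_mem.mpr
      ⟨Finset.mem_filter.mpr ⟨hmem a, ha⟩, fun S hS => ?_⟩
    obtain ⟨hS, hDS⟩ := Finset.mem_filter.mp hS
    obtain ⟨b, -, rfl⟩ := Finset.mem_image.mp hS
    by_contra hne
    have hba : b ≠ a := by
      rintro rfl
      exact hne rfl
    exact Finset.disjoint_left.mp (hdisj b a hba) hDS ha

theorem card_filter_isTotalFamily_synthemeFamily :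
    (Finset.univ.filter fun f => IsTotalFamily (synthemeFamily f)).card = 6 := by
  simp only [isTotalFamily_synthemeFamily_iff]
  decide +kernel

/-- There are exactly six totals. -/
theorem card_totals_eq_six :
    (Finset.univ.filter IsTotalFamily).card = 6 := by
  refine Eq.trans ?_ card_filter_isTotalFamily_synthemeFamily
  rw [← Finset.card_image_of_injective _ synthemeFamily_injective]
  refine congrArg Finset.card ?_
  ext T
  simp only [Finset.mem_filter, Finset.mem_univ, true_and, Finset.mem_image]
  constructor
  · intro hT
    obtain ⟨f, rfl⟩ := hT.exists_eq_synthemeFamily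
    exact ⟨f, hT, rfl⟩
  · rintro ⟨f, hf, rfl⟩
    exact hf
end
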